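/- Let G be a connected finite simple graph with maximum degree Δ(G) ≥ 1. Then χ_D(G) ≤ 2Δ(G), and equality holds if and only if G is isomorphic to the complete bipartite graph K_{Δ(G),Δ(G)} or to the cycle C_6 on six vertices. -/

import Mathlib

open SimpleGraph

/-- A proper colouring `c` of `G` is distinguishing if the identity is the only
automorphism of `G` preserving `c`. -/
def SimpleGraph.IsDistinguishingColoring {V α : Type*} (G : SimpleGraph V)
    (c : G.Coloring α) : Prop :=
  ∀ φ : G ≃g G, (∀ v, c (φ v) = c v) → ∀ v, φ v = v

/-- The distinguishing chromatic number of `G`: the least `k` such that `G` has a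
proper vertex colouring with `k` colours preserved only by the identity automorphism. -/
noncomputable def SimpleGraph.distChromNum {V : Type*} (G : SimpleGraph V) : ℕ :=
  sInf {k | ∃ c : G.Coloring (Fin k), G.IsDistinguishingColoring c}

/-- The maximum degree of `G`, stated without decidability assumptions. -/
noncomputable def SimpleGraph.maxDeg {V : Type*} [Fintype V] (G : SimpleGraph V) : ℕ := by
  classical exact G.maxDegree

/-- `G` contains no induced subgraph isomorphic to `H`. -/
def SimpleGraph.IsFreeOf {V W : Type*} (G : SimpleGraph V) (H : SimpleGraph W) : Prop :=
  ¬ Nonempty (H ↪g G)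



namespace DCN

/-- Neighbour finset, with no decidability assumptions. -/
noncomputable def nb {V : Type*} [Fintype V] (G : SimpleGraph V) (v : V) : Finset V := by
  classical exact Finset.univ.filter (fun w => G.Adj v w)

theorem mem_nb {V : Type*} [Fintype V] {G : SimpleGraph V} {v w : V} :
    w ∈ nb G v ↔ G.Adj v w := by
  classical
  simp [nb]

theorem nb_eq {V : Type*} [Fintype V] (G : SimpleGraph V) (v : V)
    [Fintype (G.neighborSet v)] : nb G v = G.neighborFinset v := by
  ext w; simp [mem_nb]

theorem card_nb_le {V : Type*} [Fintype V] (G : SimpleGraph V) (v : V) :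
    (nb G v).card ≤ G.maxDeg := by
  classical
  have h := G.degree_le_maxDegree v
  rw [← SimpleGraph.card_neighborFinset_eq_degree, ← nb_eq] at h
  unfold SimpleGraph.maxDeg
  convert h

theorem exists_card_nb {V : Type*} [Fintype V] [Nonempty V] (G : SimpleGraph V) :
    ∃ v, (nb G v).card = G.maxDeg := by
  classical
  obtain ⟨v, hv⟩ := G.exists_maximal_degree_vertex
  refine ⟨v, ?_⟩
  rw [← SimpleGraph.card_neighborFinset_eq_degree, ← nb_eq] at hv
  unfold SimpleGraph.maxDeg
  rw [← hv]

/-- The twin class of `v`. -/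
noncomputable def tw {V : Type*} [Fintype V] (G : SimpleGraph V) (v : V) : Finset V := by
  classical exact Finset.univ.filter (fun w => nb G w = nb G v)

theorem mem_tw {V : Type*} [Fintype V] {G : SimpleGraph V} {v w : V} :
    w ∈ tw G v ↔ nb G w = nb G v := by
  classical
  simp [tw]

/-- `v` has degree `k` and at least `k-2` further twins. -/
def Bad {V : Type*} [Fintype V] (G : SimpleGraph V) (k : ℕ) (v : V) : Prop :=
  (nb G v).card = k ∧ k ≤ (tw G v).card + 1

theorem nb_iso {V : Type*} [Fintype V] {G : SimpleGraph V} (φ : G ≃g G) (v : V) :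
    nb G (φ v) = (nb G v).map φ.toEquiv.toEmbedding := by
  ext w
  simp only [mem_nb, Finset.mem_map]
  constructor
  · intro h
    refine ⟨φ.symm w, ?_, by simp⟩
    rw [← φ.map_adj_iff]; simpa using h
  · rintro ⟨u, hu, rfl⟩
    exact φ.map_adj_iff.2 hu

theorem bad_iso {V : Type*} [Fintype V] {G : SimpleGraph V} {k : ℕ} (φ : G ≃g G) {v : V}
    (h : Bad G k (φ v)) : Bad G k v := by
  obtain ⟨h1, h2⟩ := h
  have htw : tw G (φ v) = (tw G v).map φ.toEquiv.toEmbedding := by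
    ext w
    simp only [mem_tw, Finset.mem_map]
    constructor
    · intro h
      refine ⟨φ.symm w, ?_, by simp⟩
      have : w = φ (φ.symm w) := by simp
      rw [this, nb_iso φ (φ.symm w), nb_iso φ v] at h
      exact Finset.map_injective _ h
    · rintro ⟨u, hu, rfl⟩
      have := nb_iso φ u
      rw [hu, ← nb_iso] at this
      exact this
  rw [nb_iso, Finset.card_map] at h1
  rw [htw, Finset.card_map] at h2
  exact ⟨h1, h2⟩

/-- Greedy choice along a rank function. -/
theorem greedy {V O : Type*} [LinearOrder O] [WellFoundedLT O] (K : V → O)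
    (P : V → (V → ℕ) → ℕ → Prop)
    (hext : ∀ v c c' a, (∀ w, K w < K v → c w = c' w) → P v c a → P v c' a)
    (hex : ∀ v c, ∃ a, P v c a) : ∃ c : V → ℕ, ∀ v, P v c (c v) := by
  classical
  have wf : WellFounded (fun a b : V => K a < K b) := InvImage.wf K wellFounded_lt
  let F : ∀ v, (∀ w, K w < K v → ℕ) → ℕ := fun v ih =>
    Classical.choose (hex v (fun w => if h : K w < K v then ih w h else 0))
  refine ⟨wf.fix F, fun v => ?_⟩
  rw [wf.fix_eq]
  refine hext v _ _ _ ?_ (Classical.choose_spec (hex v _))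
  intro w hw
  simp [hw]

/-- A rank function in which every non-root vertex has an earlier neighbour. -/
theorem exists_rank {V : Type*} [Fintype V] {G : SimpleGraph V} (hconn : G.Connected) (x : V) :
    ∃ r : V → ℕ, Function.Injective r ∧ ∀ v, v ≠ x → ∃ u, G.Adj v u ∧ r u < r v := by
  classical
  let e := Fintype.equivFin V
  refine ⟨fun v => G.dist x v * Fintype.card V + e v, ?_, ?_⟩
  · intro u v h
    apply e.injective
    ext
    have h1 := congrArg (· % Fintype.card V) h
    simpa [Nat.mul_add_mod_of_lt, (e u).2, (e v).2, Nat.mod_eq_of_lt] using h1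
  · intro v hv
    obtain ⟨p, hp⟩ := (hconn v x).exists_walk_length_eq_dist
    cases p with
    | nil => exact absurd rfl hv
    | cons h q =>
      rename_i u
      refine ⟨u, h, ?_⟩
      have h1 : G.dist u x ≤ q.length := SimpleGraph.dist_le q
      simp only [SimpleGraph.Walk.length_cons] at hp
      dsimp only
      rw [SimpleGraph.dist_comm (u := x) (v := u), SimpleGraph.dist_comm (u := x) (v := v), ← hp]
      have h2 := (e u).2
      have h3 : G.dist u x * Fintype.card V ≤ q.length * Fintype.card V :=
        Nat.mul_le_mul_right _ h1
      have : (q.length + 1) * Fintype.card V = q.length * Fintype.card V + Fintype.card V := by ring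
      omega

theorem main_coloring {V : Type*} [Fintype V] {G : SimpleGraph V} (hconn : G.Connected) (k : ℕ)
    (hk : 2 ≤ k) (hdeg : ∀ v, (nb G v).card ≤ k) (x : V) (hx : ¬ Bad G k x) :
    ∃ c : V → ℕ, (∀ v, c v < 2 * k - 1) ∧ (∀ u v, G.Adj u v → c u ≠ c v) ∧
      ∀ φ : G ≃g G, (∀ v, c (φ v) = c v) → ∀ v, φ v = v := by
  classical
  obtain ⟨r, rinj, hr⟩ := exists_rank hconn x
  -- the root is the first vertex
  have hxmin : ∀ n v, r v = n → v ≠ x → r x < r v := by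
    intro n
    induction n using Nat.strong_induction_on with
    | _ n ih =>
      intro v hv hvx
      obtain ⟨u, -, hu⟩ := hr v hvx
      by_cases hux : u = x
      · rwa [hux] at hu
      · exact (ih (r u) (hv ▸ hu) u rfl hux).trans hu
  have hxmin' : ∀ v, r x ≤ r v := fun v => by
    by_cases h : v = x
    · rw [h]
    · exact (hxmin _ v rfl h).le
  -- the parent
  have hpar : ∀ v, ∃ p, v ≠ x → G.Adj v p ∧ r p < r v ∧ ∀ w, G.Adj v w → r p ≤ r w := by
    intro v
    by_cases hv : v = x
    · exact ⟨v, fun h => absurd hv h⟩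
    · obtain ⟨u, hu, huv⟩ := hr v hv
      obtain ⟨p, hp, hmin⟩ := Finset.exists_min_image (nb G v) r ⟨u, mem_nb.2 hu⟩
      exact ⟨p, fun _ => ⟨mem_nb.1 hp, (hmin u (mem_nb.2 hu)).trans_lt huv,
        fun w hw => hmin w (mem_nb.2 hw)⟩⟩
  choose par hpar using hpar
  let K : V → ℕ ×ₗ ℕ := fun v => if v = x then toLex (0, 0) else toLex (r (par v) + 1, r v)
  have hKx : ∀ v, v ≠ x → K x < K v := by
    intro v hv
    simp [K, hv, Prod.Lex.toLex_lt_toLex]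
  have hK : ∀ u v, u ≠ x → v ≠ x → (K u < K v ↔ r (par u) < r (par v) ∨
      (par u = par v ∧ r u < r v)) := by
    intro u v hu hv
    simp only [K, hu, hv, if_false, Prod.Lex.toLex_lt_toLex]
    constructor
    · rintro (h | ⟨h, h'⟩)
      · left; omega
      · right; exact ⟨rinj (by simpa using h), h'⟩
    · rintro (h | ⟨h, h'⟩)
      · left; simpa using h
      · right; exact ⟨by simp [h], h'⟩
  let tight : V → Prop := fun v => ∀ w, G.Adj v w → w = x ∨ r (par w) < r (par v)
  let A : V → Finset V := fun v => (nb G v).filter (fun w => w ≠ x ∧ K w < K v)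
  let B : V → Finset V := fun v => Finset.univ.filter
    (fun u => u ≠ x ∧ par u = par v ∧ K u < K v ∧ (tight v → nb G u = nb G v))
  let P : V → (V → ℕ) → ℕ → Prop := fun v c a =>
    (v = x → a = 0) ∧ (v ≠ x → a < 2 * k - 1 ∧ a ∉ (A v ∪ B v).image c ∧
      (a = 0 → Bad G k v ∧ ¬ G.Adj x v))
  obtain ⟨c, hc⟩ : ∃ c : V → ℕ, ∀ v, P v c (c v) := by
    apply greedy K P
    · intro v c c' a h ⟨h1, h2⟩
      refine ⟨h1, fun hv => ?_⟩
      obtain ⟨h3, h4, h5⟩ := h2 hv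
      refine ⟨h3, ?_, h5⟩
      have : (A v ∪ B v).image c' = (A v ∪ B v).image c := by
        apply Finset.image_congr
        intro w hw
        refine (h w ?_).symm
        simp only [A, B, Finset.coe_union, Set.mem_union, Finset.mem_coe, Finset.mem_filter] at hw
        rcases hw with hw | hw
        · exact hw.2.2
        · exact hw.2.2.2.1
      rwa [this]
    · intro v c
      by_cases hv : v = x
      · exact ⟨0, fun _ => rfl, fun h => absurd hv h⟩
      by_cases hex : ∃ a, 1 ≤ a ∧ a < 2 * k - 1 ∧ a ∉ (A v ∪ B v).image c
      · obtain ⟨a, h1, h2, h3⟩ := hex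
        exact ⟨a, fun h => absurd h hv, fun _ => ⟨h2, h3, fun h => by omega⟩⟩
      push Not at hex
      have hsub : Finset.Ico 1 (2 * k - 1) ⊆ (A v ∪ B v).image c := by
        intro a ha
        rw [Finset.mem_Ico] at ha
        exact hex a ha.1 ha.2
      have hQ : 2 * k - 2 ≤ (A v ∪ B v).card := by
        have := (Finset.card_le_card hsub).trans Finset.card_image_le
        rw [Nat.card_Ico] at this
        omega
      obtain ⟨hp1, hp2, hp3⟩ := hpar v hv
      have hvB : v ∉ B v := by simp [B]
      have hpx : par v ≠ x := by
        intro hpx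
        have hsub2 : A v ∪ B v ⊆ (nb G x).erase v := by
          intro w hw
          simp only [A, B, Finset.mem_union, Finset.mem_filter, Finset.mem_univ, true_and] at hw
          have hwx : w ≠ x := by tauto
          have hlt : K w < K v := by tauto
          have hpw : par w = x := by
            rcases (hK w v hwx hv).1 hlt with h | h
            · rw [hpx] at h
              exact absurd h (not_lt.2 (hxmin' _))
            · rw [h.1, hpx]
          rw [Finset.mem_erase, mem_nb]
          refine ⟨fun h => ?_, ?_⟩
          · rw [h] at hlt; exact lt_irrefl _ hlt
          · rw [← hpw]; exact (hpar w hwx).1.symm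
        have h1 := Finset.card_le_card hsub2
        have hvx : v ∈ nb G x := by rw [mem_nb, ← hpx]; exact hp1.symm
        rw [Finset.card_erase_of_mem hvx] at h1
        have := hdeg x
        have : 0 < (nb G x).card := Finset.card_pos.2 ⟨v, hvx⟩
        omega
      have hBcard : (B v).card ≤ k - 2 := by
        have hsub3 : B v ⊆ ((nb G (par v)).erase v).erase (par (par v)) := by
          intro w hw
          simp only [B, Finset.mem_filter, Finset.mem_univ, true_and] at hw
          obtain ⟨hwx, hpw, hlt, -⟩ := hw
          have := hpar w hwx
          have h2 := hpar _ hpx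
          rw [Finset.mem_erase, Finset.mem_erase, mem_nb]
          refine ⟨?_, ?_, ?_⟩
          · intro h
            rw [← h, ← hpw] at h2
            omega
          · intro h; rw [h] at hlt; exact lt_irrefl _ hlt
          · rw [← hpw]; exact this.1.symm
        have h1 := Finset.card_le_card hsub3
        have hm1 : v ∈ nb G (par v) := mem_nb.2 hp1.symm
        have h2 := hpar _ hpx
        have hm2 : par (par v) ∈ (nb G (par v)).erase v := by
          rw [Finset.mem_erase, mem_nb]
          refine ⟨?_, h2.1⟩
          intro h
          rw [h] at h2
          omega
        rw [Finset.card_erase_of_mem hm2, Finset.card_erase_of_mem hm1] at h1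
        have := hdeg (par v)
        omega
      have hAsub : A v ⊆ nb G v := Finset.filter_subset _ _
      have hAcard : (A v).card ≤ k := (Finset.card_le_card hAsub).trans (hdeg v)
      have hun := Finset.card_union_add_card_inter (A v) (B v)
      have hAk : (A v).card = k := by omega
      have hBk : (B v).card = k - 2 := by omega
      have hint : A v ∩ B v = ∅ := by
        rw [← Finset.card_eq_zero]; omega
      have hAeq : A v = nb G v := Finset.eq_of_subset_of_card_le hAsub (by rw [hAk]; exact hdeg v)
      have hnx : ¬ G.Adj x v := by
        intro h
        have : x ∈ A v := by rw [hAeq, mem_nb]; exact h.symm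
        simp [A] at this
      have htight' : ∀ w, G.Adj v w → w ≠ x ∧ K w < K v := by
        intro w hw
        have : w ∈ A v := by rw [hAeq, mem_nb]; exact hw
        exact (Finset.mem_filter.1 this).2
      have htw : B v ⊆ tw G v := by
        by_cases ht : tight v
        · intro w hw
          simp only [B, Finset.mem_filter, Finset.mem_univ, true_and] at hw
          exact mem_tw.2 (hw.2.2.2 ht)
        · exfalso
          apply ht
          intro w hw
          obtain ⟨hwx, hlt⟩ := htight' w hw
          right
          rcases (hK w v hwx hv).1 hlt with h | h
          · exact h
          · exfalso
            have h1 : w ∈ A v ∩ B v := by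
              rw [Finset.mem_inter]
              refine ⟨by rw [hAeq, mem_nb]; exact hw, ?_⟩
              simp only [B, Finset.mem_filter, Finset.mem_univ, true_and]
              exact ⟨hwx, h.1, hlt, fun h => absurd h ht⟩
            rw [hint] at h1
            simp at h1
      refine ⟨0, fun h => absurd h hv, fun _ => ⟨by omega, ?_, fun _ => ⟨⟨?_, ?_⟩, hnx⟩⟩⟩
      · intro h0
        have hsub4 : Finset.range (2 * k - 1) ⊆ (A v ∪ B v).image c := by
          intro a ha
          rw [Finset.mem_range] at ha
          by_cases h : a = 0
          · rw [h]; exact h0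
          · exact hex a (by omega) ha
        have := (Finset.card_le_card hsub4).trans Finset.card_image_le
        rw [Finset.card_range] at this
        omega
      · rw [← hAeq, hAk]
      · have : insert v (B v) ⊆ tw G v := by
          intro w hw
          rcases Finset.mem_insert.1 hw with h | h
          · rw [h, mem_tw]
          · exact htw h
        have := Finset.card_le_card this
        rw [Finset.card_insert_of_notMem hvB] at this
        omega
  have hcx : c x = 0 := (hc x).1 rfl
  have hedge : ∀ u v, G.Adj u v → K u < K v → c u ≠ c v := by
    intro u v h hlt
    have hv : v ≠ x := by
      intro hv
      by_cases hu : u = x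
      · rw [hu, hv] at h; exact h.ne rfl
      · rw [hv] at hlt; exact lt_asymm hlt (hKx u hu)
    obtain ⟨-, h2, h3⟩ := (hc v).2 hv
    by_cases hu : u = x
    · intro heq
      rw [hu, hcx] at heq
      exact (h3 heq.symm).2 (hu ▸ h)
    · intro heq
      apply h2
      rw [← heq]
      apply Finset.mem_image_of_mem
      apply Finset.mem_union_left
      simp only [A, Finset.mem_filter, mem_nb]
      exact ⟨h.symm, hu, hlt⟩
  have hKinj : ∀ u v, K u = K v → u = v := by
    intro u v h
    by_cases hu : u = x
    · by_cases hv : v = x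
      · rw [hu, hv]
      · exact absurd h (hu ▸ (hKx v hv).ne)
    · by_cases hv : v = x
      · exact absurd h (hv ▸ (hKx u hu).ne')
      · simp only [K, hu, hv, if_false] at h
        exact rinj (congrArg (fun z => (ofLex z).2) h)
  refine ⟨c, ?_, ?_, ?_⟩
  · intro v
    by_cases hv : v = x
    · rw [hv, hcx]; omega
    · exact ((hc v).2 hv).1
  · intro u v h
    rcases lt_trichotomy (K u) (K v) with hlt | heq | hlt
    · exact hedge u v h hlt
    · exact absurd (hKinj u v heq) h.ne
    · exact (hedge v u h.symm hlt).symm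
  · intro φ hφ
    have hφx : φ x = x := by
      by_contra hne
      have h1 := ((hc (φ x)).2 hne).2.2 (by rw [hφ, hcx])
      exact hx (bad_iso φ h1.1)
    have key : ∀ n v, v ≠ x → r (par v) = n → φ v = v := by
      intro n
      induction n using Nat.strong_induction_on with
      | _ n ih =>
        intro v hv hn
        have hp := hpar v hv
        have hφp : φ (par v) = par v := by
          by_cases hpx : par v = x
          · rw [hpx, hφx]
          · exact ih _ (hn ▸ (hpar _ hpx).2.1) _ hpx rfl
        have hux : φ v ≠ x := by
          intro h
          rw [← hφx] at h
          exact hv (φ.injective h)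
        have hadj : G.Adj (φ v) (par v) := by
          have := φ.map_adj_iff.2 hp.1
          rwa [hφp] at this
        have hpu := hpar _ hux
        rcases (hpu.2.2 _ hadj).lt_or_eq with hlt | heq
        · exact φ.injective (ih _ (hn ▸ hlt) _ hux rfl)
        · have hpe : par (φ v) = par v := rinj heq
          have hfix : ∀ z, par z = par v → tight z → ∀ w, G.Adj z w → φ w = w := by
            intro z hz ht w hw
            rcases ht w hw with h | h
            · rw [h, hφx]
            · by_cases hwx : w = x
              · rw [hwx, hφx]
              · exact ih _ (by rw [← hn, ← hz]; exact h) w hwx rfl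
          by_contra hne
          have hsep : ∀ y z, y ≠ x → z ≠ x → par y = par z → c y = c z →
              (tight z → nb G y = nb G z) → ¬ K y < K z := by
            intro y z hy hz hyz hcyz ht hlt
            apply ((hc z).2 hz).2.1
            rw [← hcyz]
            apply Finset.mem_image_of_mem
            apply Finset.mem_union_right
            simp only [B, Finset.mem_filter, Finset.mem_univ, true_and]
            exact ⟨hy, hyz, hlt, ht⟩
          have s1 : ¬ K v < K (φ v) := by
            refine hsep v (φ v) hv hux hpe.symm (hφ v).symm ?_
            intro ht
            have hf := hfix _ hpe ht
            ext w
            rw [mem_nb, mem_nb]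
            constructor
            · intro h
              have h1 := φ.map_adj_iff.2 h
              have h2 := φ.injective (hf _ h1)
              rwa [h2] at h1
            · intro h
              have h1 := hf _ h
              rw [← h1] at h
              exact φ.map_adj_iff.1 h
          have s2 : ¬ K (φ v) < K v := by
            refine hsep (φ v) v hux hv hpe (hφ v) ?_
            intro ht
            have hf := hfix _ rfl ht
            ext w
            rw [mem_nb, mem_nb]
            constructor
            · intro h
              have h1 : G.Adj v (φ.symm w) := by
                rw [← φ.map_adj_iff]; simpa using h
              have h2 := hf _ h1
              simp only [RelIso.apply_symm_apply] at h2
              rwa [← h2] at h1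
            · intro h
              have h1 := φ.map_adj_iff.2 h
              rwa [hf _ h] at h1
          exact hne (hKinj _ _ (le_antisymm (not_lt.1 s1) (not_lt.1 s2)))
    intro v
    by_cases hv : v = x
    · rw [hv, hφx]
    · exact key _ v hv rfl

/-- `G` has a distinguishing proper colouring with colours `< m`. -/
def Good {V : Type*} (G : SimpleGraph V) (m : ℕ) : Prop :=
  ∃ c : V → ℕ, (∀ v, c v < m) ∧ (∀ u v, G.Adj u v → c u ≠ c v) ∧
      ∀ φ : G ≃g G, (∀ v, c (φ v) = c v) → ∀ v, φ v = v

theorem good_iff {V : Type*} (G : SimpleGraph V) (m : ℕ) :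
    Good G m ↔ ∃ c : G.Coloring (Fin m), G.IsDistinguishingColoring c := by
  constructor
  · rintro ⟨c, h1, h2, h3⟩
    refine ⟨SimpleGraph.Coloring.mk (fun v => ⟨c v, h1 v⟩) ?_, ?_⟩
    · intro u v h heq
      exact h2 u v h (by simpa using heq)
    · intro φ hφ
      refine h3 φ fun v => ?_
      have := hφ v
      exact congrArg Fin.val this
  · rintro ⟨c, hc⟩
    refine ⟨fun v => (c v).val, fun v => (c v).2, ?_, ?_⟩
    · intro u v h heq
      exact c.valid h (Fin.ext heq)
    · intro φ hφ
      exact hc φ fun v => Fin.ext (hφ v)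

theorem dist_le {V : Type*} {G : SimpleGraph V} {m : ℕ} (h : Good G m) : G.distChromNum ≤ m :=
  Nat.sInf_le ((good_iff G m).1 h)

theorem le_dist {V : Type*} {G : SimpleGraph V} {m n : ℕ} (h : Good G m)
    (hn : ∀ l, Good G l → n ≤ l) : n ≤ G.distChromNum := by
  apply hn
  rw [good_iff]
  exact Nat.sInf_mem (s := {k | ∃ c : G.Coloring (Fin k), G.IsDistinguishingColoring c})
    ⟨m, (good_iff G m).1 h⟩

theorem good_iso {V W : Type*} {G : SimpleGraph V} {H : SimpleGraph W} (e : G ≃g H) {m : ℕ}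
    (h : Good H m) : Good G m := by
  obtain ⟨c, h1, h2, h3⟩ := h
  refine ⟨fun v => c (e v), fun v => h1 _, fun u v h => h2 _ _ (e.map_adj_iff.2 h), ?_⟩
  intro φ hφ v
  have := h3 ((e.symm.trans φ).trans e) (fun w => by
    have := hφ (e.symm w)
    simpa using this) (e v)
  simpa using this

theorem good_mono {V : Type*} {G : SimpleGraph V} {m n : ℕ} (hmn : m ≤ n) (h : Good G m) :
    Good G n := by
  obtain ⟨c, h1, h2⟩ := h
  exact ⟨c, fun v => (h1 v).trans_le hmn, h2⟩

theorem good_bip (k : ℕ) : Good (completeBipartiteGraph (Fin k) (Fin k)) (2 * k) := by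
  have hinj : Function.Injective
      (fun v : Fin k ⊕ Fin k => Sum.elim (fun i : Fin k => i.val) (fun i : Fin k => k + i.val) v) := by
    rintro (u | u) (v | v) h
    · simp at h; rw [Fin.ext h]
    · simp at h; omega
    · simp at h; omega
    · simp at h; rw [Fin.ext h]
  refine ⟨fun v : Fin k ⊕ Fin k => Sum.elim (fun i : Fin k => i.val) (fun i : Fin k => k + i.val) v,
    ?_, ?_, ?_⟩
  rotate_left
  · intro u v h heq
    exact h.ne (hinj heq)
  · intro φ hφ v
    exact hinj (hφ v)
  · rintro (v | v)
    · simp; omega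
    · simp; omega

/-- Permuting each side is an automorphism of the complete bipartite graph. -/
def bipIso {k : ℕ} (s t : Equiv.Perm (Fin k)) :
    completeBipartiteGraph (Fin k) (Fin k) ≃g completeBipartiteGraph (Fin k) (Fin k) where
  toEquiv := Equiv.sumCongr s t
  map_rel_iff' := by
    rintro (a | a) (b | b) <;> simp

theorem bip_lower {k m : ℕ} (h : Good (completeBipartiteGraph (Fin k) (Fin k)) m) :
    2 * k ≤ m := by
  obtain ⟨c, h1, h2, h3⟩ := h
  have hinj : Function.Injective c := by
    rintro (u | u) (v | v) huv
    · by_contra hne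
      have := h3 (bipIso (Equiv.swap u v) 1) (by
        rintro (w | w)
        · change c (Sum.inl (Equiv.swap u v w)) = _
          by_cases hw : w = u
          · rw [hw, Equiv.swap_apply_left, huv]
          · by_cases hw' : w = v
            · rw [hw', Equiv.swap_apply_right, huv]
            · rw [Equiv.swap_apply_of_ne_of_ne hw hw']
        · rfl) (Sum.inl u)
      change Sum.inl (Equiv.swap u v u) = _ at this
      rw [Equiv.swap_apply_left] at this
      exact hne this.symm
    · exact absurd huv (h2 _ _ (by simp))
    · exact absurd huv (h2 _ _ (by simp))
    · by_contra hne
      have := h3 (bipIso 1 (Equiv.swap u v)) (by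
        rintro (w | w)
        · rfl
        · change c (Sum.inr (Equiv.swap u v w)) = _
          by_cases hw : w = u
          · rw [hw, Equiv.swap_apply_left, huv]
          · by_cases hw' : w = v
            · rw [hw', Equiv.swap_apply_right, huv]
            · rw [Equiv.swap_apply_of_ne_of_ne hw hw']) (Sum.inr u)
      change Sum.inr (Equiv.swap u v u) = _ at this
      rw [Equiv.swap_apply_left] at this
      exact hne this.symm
  have := Finset.card_le_card_of_injOn (s := Finset.univ) (t := Finset.range m) c
    (fun v _ => by simpa using h1 v) hinj.injOn
  simp at this
  omega

theorem closed_univ {V : Type*} {G : SimpleGraph V} (hconn : G.Connected) (S : Set V) (x : V)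
    (hx : x ∈ S) (hS : ∀ u v, u ∈ S → G.Adj u v → v ∈ S) (y : V) : y ∈ S := by
  obtain ⟨p⟩ := hconn x y
  induction p with
  | nil => exact hx
  | cons h q ih => exact ih (hS _ _ hx h)

theorem bip_struct {V : Type*} [Fintype V] {G : SimpleGraph V} (hconn : G.Connected) (k : ℕ)
    (A B : Finset V) (hA : A.card = k) (hB : B.card = k) (hk : 1 ≤ k)
    (hAB : ∀ a ∈ A, nb G a = B) (hBA : ∀ b ∈ B, nb G b = A) :
    Nonempty (G ≃g completeBipartiteGraph (Fin k) (Fin k)) := by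
  classical
  obtain ⟨a, ha⟩ : A.Nonempty := Finset.card_pos.1 (by omega)
  have hdisj : ∀ v, v ∈ A → v ∉ B := by
    intro v hv hv'
    rw [← hAB v hv, mem_nb] at hv'
    exact hv'.ne rfl
  have hall : ∀ v, v ∈ A ∨ v ∈ B := by
    intro v
    refine closed_univ hconn {v | v ∈ A ∨ v ∈ B} a (Or.inl ha) ?_ v
    rintro u w (hu | hu) h
    · right; rw [← hAB u hu, mem_nb]; exact h
    · left; rw [← hBA u hu, mem_nb]; exact h
  have hcompl : ∀ v, v ∉ A ↔ v ∈ B := fun v =>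
    ⟨fun h => (hall v).resolve_left h, fun h h' => hdisj v h' h⟩
  have e1 : {v // v ∈ A} ≃ Fin k := Fintype.equivFinOfCardEq (by simp [hA])
  have e2 : {v // ¬ v ∈ A} ≃ Fin k := Fintype.equivFinOfCardEq (by
    rw [Fintype.card_of_subtype B (fun v => (hcompl v).symm), hB])
  let e : Fin k ⊕ Fin k ≃ V := (Equiv.sumCongr e1.symm e2.symm).trans (Equiv.sumCompl (· ∈ A))
  have hl : ∀ i, e (Sum.inl i) ∈ A := fun i => by simp [e]
  have hr : ∀ i, e (Sum.inr i) ∈ B := fun i => by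
    rw [← hcompl]; simp only [e, Equiv.trans_apply, Equiv.sumCongr_apply, Sum.map_inr,
      Equiv.sumCompl_apply_inr]; exact (e2.symm i).2
  refine ⟨(RelIso.mk e ?_ : completeBipartiteGraph (Fin k) (Fin k) ≃g G).symm⟩
  rintro (i | i) (j | j)
  · rw [← mem_nb, hAB _ (hl i)]
    simpa using hdisj _ (hl j)
  · rw [← mem_nb, hAB _ (hl i)]
    simpa using hr j
  · rw [← mem_nb, hBA _ (hr i)]
    simpa using hl j
  · rw [← mem_nb, hBA _ (hr i)]
    simpa using (hcompl _).2 (hr j)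

theorem all_bad {V : Type*} [Fintype V] {G : SimpleGraph V} (hconn : G.Connected) (k : ℕ)
    (hk : 3 ≤ k) (hbad : ∀ v, Bad G k v) :
    Nonempty (G ≃g completeBipartiteGraph (Fin k) (Fin k)) := by
  classical
  obtain ⟨y⟩ := hconn.nonempty
  obtain ⟨b, hb⟩ : (nb G y).Nonempty := Finset.card_pos.1 (by rw [(hbad y).1]; omega)
  have htsub : ∀ b ∈ nb G y, tw G b ⊆ nb G y := by
    intro b hb u hu
    rw [mem_tw] at hu
    rw [mem_nb] at hb ⊢
    have : y ∈ nb G u := by rw [hu, mem_nb]; exact hb.symm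
    exact (mem_nb.1 this).symm
  have hBA : ∀ b' ∈ nb G y, nb G b' = nb G b := by
    intro b' hb'
    by_contra hne
    have hd : Disjoint (tw G b) (tw G b') := by
      rw [Finset.disjoint_left]
      intro u h1 h2
      rw [mem_tw] at h1 h2
      exact hne (h2.symm.trans h1)
    have h1 := Finset.card_le_card (Finset.union_subset (htsub b hb) (htsub b' hb'))
    rw [Finset.card_union_of_disjoint hd, (hbad y).1] at h1
    have h2 := (hbad b).2
    have h3 := (hbad b').2
    omega
  refine bip_struct hconn k (nb G b) (nb G y) (hbad b).1 (hbad y).1 (by omega) ?_ hBA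
  intro a ha
  symm
  apply Finset.eq_of_subset_of_card_le
  · intro b' hb'
    rw [← hBA b' hb', mem_nb] at ha
    exact mem_nb.2 ha.symm
  · rw [(hbad a).1, (hbad y).1]

theorem deg_one {V : Type*} [Fintype V] {G : SimpleGraph V} (hconn : G.Connected)
    (hk : G.maxDeg = 1) : Nonempty (G ≃g completeBipartiteGraph (Fin 1) (Fin 1)) := by
  classical
  have := hconn.nonempty
  obtain ⟨x, hx⟩ := exists_card_nb G
  rw [hk] at hx
  obtain ⟨y, hy⟩ := Finset.card_eq_one.1 hx
  have hxy : G.Adj x y := by rw [← mem_nb, hy]; simp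
  have hyx : nb G y = {x} := by
    symm
    apply Finset.eq_of_subset_of_card_le
    · intro z hz; rw [Finset.mem_singleton.1 hz, mem_nb]; exact hxy.symm
    · have := card_nb_le G y
      simp; omega
  refine bip_struct hconn 1 {x} {y} rfl rfl le_rfl ?_ ?_
  · intro a ha; rw [Finset.mem_singleton.1 ha, hy]
  · intro a ha; rw [Finset.mem_singleton.1 ha, hyx]

theorem cyc_adj {n : ℕ} (hn : 3 ≤ n) (i j : Fin n) : (cycleGraph n).Adj i j ↔
    j.val = i.val + 1 ∨ i.val = j.val + 1 ∨ (i.val = 0 ∧ j.val + 1 = n) ∨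
      (j.val = 0 ∧ i.val + 1 = n) := by
  have hsub : ∀ i j : Fin n, (i - j).val = if j.val ≤ i.val then i.val - j.val
      else n + i.val - j.val := by
    intro i j
    rw [Fin.sub_def]
    have := i.2
    have := j.2
    simp only
    split_ifs with h
    · rw [show n - j.val + i.val = (i.val - j.val) + n by omega, Nat.add_mod_right,
        Nat.mod_eq_of_lt (by omega)]
    · rw [Nat.mod_eq_of_lt (by omega)]; omega
  rw [cycleGraph_adj', hsub, hsub]
  have := i.2
  have := j.2
  split_ifs <;> omega

theorem cyc_rigid {n : ℕ} (hn : 3 ≤ n) (φ : cycleGraph n ≃g cycleGraph n)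
    (h0 : φ ⟨0, by omega⟩ = ⟨0, by omega⟩) (h1 : φ ⟨1, by omega⟩ = ⟨1, by omega⟩) (i : Fin n) :
    φ i = i := by
  have key : ∀ m (hm : m < n), φ ⟨m, hm⟩ = ⟨m, hm⟩ := by
    intro m
    induction m using Nat.strong_induction_on with
    | _ m ih =>
      intro hm
      by_cases hm0 : m = 0
      · subst hm0; exact h0
      by_cases hm1 : m = 1
      · subst hm1; exact h1
      have e1 := ih (m - 1) (by omega) (by omega)
      have e2 := ih (m - 2) (by omega) (by omega)
      have hadj : (cycleGraph n).Adj ⟨m - 1, by omega⟩ ⟨m, hm⟩ := by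
        rw [cyc_adj hn]; left; simp only; omega
      have hadj' := φ.map_adj_iff.2 hadj
      rw [e1, cyc_adj hn] at hadj'
      have hne : φ ⟨m, hm⟩ ≠ φ ⟨m - 2, by omega⟩ := by
        intro h
        have := congrArg Fin.val (φ.injective h)
        simp only at this
        omega
      rw [e2] at hne
      have hne' : (φ ⟨m, hm⟩).val ≠ m - 2 := fun h => hne (Fin.ext h)
      apply Fin.ext
      simp only at hadj' ⊢
      omega
  exact key i.val i.2

theorem good_cyc_odd {n : ℕ} (hn : 3 ≤ n) (hodd : n % 2 = 1) : Good (cycleGraph n) 3 := by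
  refine ⟨fun i => if i.val = 0 then 0 else if i.val % 2 = 1 then 1 else 2, ?_, ?_, ?_⟩
  · intro v; dsimp only; split_ifs <;> omega
  · intro u v h
    rw [cyc_adj hn] at h
    have := u.2
    have := v.2
    dsimp only
    split_ifs <;> omega
  · intro φ hφ
    have h0 : φ ⟨0, by omega⟩ = ⟨0, by omega⟩ := by
      have := hφ ⟨0, by omega⟩
      apply Fin.ext
      dsimp only at this ⊢
      split_ifs at this <;> omega
    refine cyc_rigid hn φ h0 ?_
    have hadj : (cycleGraph n).Adj ⟨0, by omega⟩ ⟨1, by omega⟩ := by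
      rw [cyc_adj hn]; left; rfl
    have hadj' := φ.map_adj_iff.2 hadj
    rw [h0, cyc_adj hn] at hadj'
    have := hφ ⟨1, by omega⟩
    apply Fin.ext
    dsimp only at this hadj' ⊢
    split_ifs at this <;> omega

theorem good_cyc_even {n : ℕ} (hn : 8 ≤ n) (heven : n % 2 = 0) : Good (cycleGraph n) 3 := by
  have hn3 : 3 ≤ n := by omega
  have hadj : ∀ m (hm : m + 1 < n), (cycleGraph n).Adj ⟨m, by omega⟩ ⟨m + 1, hm⟩ := by
    intro m hm
    rw [cyc_adj hn3]; left; rfl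
  refine ⟨fun i => if i.val = 0 ∨ i.val = 3 then 0 else if i.val = 1 then 1 else
    if i.val = 2 then 2 else if i.val % 2 = 0 then 1 else 2, ?_, ?_, ?_⟩
  · intro v; dsimp only; split_ifs <;> omega
  · intro u v h
    rw [cyc_adj hn3] at h
    have := u.2
    have := v.2
    dsimp only
    split_ifs <;> omega
  · intro φ hφ
    have a1 := φ.map_adj_iff.2 (hadj 0 (by omega))
    have a2 := φ.map_adj_iff.2 (hadj 1 (by omega))
    have a3 := φ.map_adj_iff.2 (hadj 2 (by omega))
    rw [cyc_adj hn3] at a1 a2 a3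
    have c0 := hφ ⟨0, by omega⟩
    have c1 := hφ ⟨1, by omega⟩
    have c2 := hφ ⟨2, by omega⟩
    have c3 := hφ ⟨3, by omega⟩
    have hne : (φ ⟨1, by omega⟩).val ≠ (φ ⟨3, by omega⟩).val := by
      intro h
      have := congrArg Fin.val (φ.injective (Fin.ext h))
      simp at this
    have b0 := (φ ⟨0, by omega⟩).2
    have b1 := (φ ⟨1, by omega⟩).2
    simp only [Nat.reduceAdd] at a1 a2 a3
    generalize hz0 : φ ⟨0, by omega⟩ = z0 at *
    generalize hz1 : φ ⟨1, by omega⟩ = z1 at *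
    generalize hz2 : φ ⟨2, by omega⟩ = z2 at *
    generalize hz3 : φ ⟨3, by omega⟩ = z3 at *
    have d0 : z0.val = 0 ∨ z0.val = 3 := by
      clear c1 c2 c3 a1 a2 a3
      dsimp only at c0
      split_ifs at c0 <;> omega
    have d3 : z3.val = 0 ∨ z3.val = 3 := by
      clear c1 c2 c0 a1 a2 a3
      dsimp only at c3
      split_ifs at c3 <;> omega
    have d1 : z1.val ≠ 0 ∧ z1.val ≠ 3 ∧ (z1.val = 1 ∨ (4 ≤ z1.val ∧ z1.val % 2 = 0)) := by
      clear c3 c2 c0 a1 a2 a3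
      simp at c1
      split_ifs at c1 <;> omega
    have d2 : z2.val ≠ 0 ∧ z2.val ≠ 3 := by
      clear c3 c1 c0 a1 a2 a3
      simp at c2
      split_ifs at c2 <;> omega
    clear c0 c1 c2 c3
    refine cyc_rigid hn3 φ ?_ ?_
    · rw [hz0]; apply Fin.ext; dsimp only; omega
    · rw [hz1]; apply Fin.ext; dsimp only; omega

theorem good_cyc_six : Good (cycleGraph 6) 4 := by
  refine ⟨fun i => ![3, 0, 1, 0, 1, 2] i, by decide, by decide, ?_⟩
  intro φ hφ
  have h0 : φ 0 = 0 := by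
    have := hφ 0
    revert this
    generalize φ 0 = z
    revert z
    decide
  refine cyc_rigid (by norm_num) φ h0 ?_
  have h1 : (cycleGraph 6).Adj (φ 0) (φ 1) := φ.map_adj_iff.2 (by decide)
  rw [h0] at h1
  have := hφ 1
  revert this h1
  change _ → _ → φ 1 = 1
  generalize φ 1 = z
  revert z
  decide

/-- Dihedral symmetries of the hexagon. -/
def rot (a : Fin 6) : cycleGraph 6 ≃g cycleGraph 6 where
  toEquiv := Equiv.addRight a
  map_rel_iff' := by
    intro u v
    simp only [Equiv.coe_addRight, cycleGraph_adj, add_sub_add_right_eq_sub]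

def refl (a : Fin 6) : cycleGraph 6 ≃g cycleGraph 6 where
  toEquiv := Equiv.subLeft a
  map_rel_iff' := by
    intro u v
    simp only [Equiv.subLeft_apply, cycleGraph_adj, sub_sub_sub_cancel_left]
    exact or_comm

theorem six_lower {m : ℕ} (h : Good (cycleGraph 6) m) : 4 ≤ m := by
  by_contra hm
  obtain ⟨c, h1, h2, h3⟩ := good_mono (show m ≤ 3 by omega) h
  have dec : ∀ c0 c1 c2 c3 c4 c5 : Fin 3, c0 ≠ c1 → c1 ≠ c2 → c2 ≠ c3 → c3 ≠ c4 → c4 ≠ c5 →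
      c5 ≠ c0 → ∃ a : Fin 6,
      (a ≠ 0 ∧ ∀ i : Fin 6, ![c0, c1, c2, c3, c4, c5] (i + a) = ![c0, c1, c2, c3, c4, c5] i) ∨
      (∀ i : Fin 6, ![c0, c1, c2, c3, c4, c5] (a - i) = ![c0, c1, c2, c3, c4, c5] i) := by
    set_option synthInstance.maxSize 1000 in
    set_option synthInstance.maxHeartbeats 200000 in
    decide +kernel
  let d : Fin 6 → Fin 3 := fun i => ⟨c i, h1 i⟩
  have hd : ∀ u v, (cycleGraph 6).Adj u v → d u ≠ d v := fun u v h heq =>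
    h2 u v h (congrArg Fin.val heq)
  have hvec : ![d 0, d 1, d 2, d 3, d 4, d 5] = d := by
    funext i; fin_cases i <;> rfl
  obtain ⟨a, ha⟩ := dec (d 0) (d 1) (d 2) (d 3) (d 4) (d 5) (hd _ _ (by decide))
    (hd _ _ (by decide)) (hd _ _ (by decide)) (hd _ _ (by decide)) (hd _ _ (by decide))
    (hd _ _ (by decide))
  rw [hvec] at ha
  rcases ha with ⟨ha, hi⟩ | hi
  · have := h3 (rot a) (fun v => congrArg Fin.val (hi v)) 0
    change 0 + a = 0 at this
    rw [zero_add] at this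
    exact ha this
  · have h4 := h3 (refl a) (fun v => congrArg Fin.val (hi v))
    have e0 : a - 0 = 0 := h4 0
    have e1 : a - 1 = 1 := h4 1
    rw [sub_zero] at e0
    rw [e0] at e1
    revert e1
    decide

theorem cyc_of_regular {V : Type*} [Fintype V] {G : SimpleGraph V} (hconn : G.Connected)
    (hreg : ∀ v, (nb G v).card = 2) : ∃ n, 3 ≤ n ∧ Nonempty (G ≃g cycleGraph n) := by
  classical
  have hne := hconn.nonempty
  have hdeg : ∀ v, G.degree v = 2 := fun v => by
    rw [← SimpleGraph.card_neighborFinset_eq_degree, ← nb_eq, hreg]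
  have hac : ¬ G.IsAcyclic := by
    intro hac
    have ht : G.IsTree := ⟨hconn, hac⟩
    have h1 := ht.card_edgeFinset
    have h2 := G.sum_degrees_eq_twice_card_edges
    simp only [hdeg, Finset.sum_const, Finset.card_univ, smul_eq_mul] at h2
    omega
  rw [isAcyclic_iff_free_cycleGraph] at hac
  push Not at hac
  obtain ⟨n, hn, hfree⟩ := hac
  obtain ⟨f⟩ := hfree
  have hinj : Function.Injective f := f.injective
  have hhom : ∀ i j, (cycleGraph n).Adj i j → G.Adj (f i) (f j) := fun i j h => f.toHom.map_adj h
  have hcdeg : ∀ i, (nb (cycleGraph n) i).card = 2 := by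
    intro i
    obtain ⟨l, rfl⟩ : ∃ l, n = l + 3 := ⟨n - 3, by omega⟩
    rw [nb_eq, SimpleGraph.card_neighborFinset_eq_degree, cycleGraph_degree_three_le]
  have himg : ∀ i, (nb (cycleGraph n) i).image f = nb G (f i) := by
    intro i
    apply Finset.eq_of_subset_of_card_le
    · intro w hw
      obtain ⟨j, hj, rfl⟩ := Finset.mem_image.1 hw
      exact mem_nb.2 (hhom _ _ (mem_nb.1 hj))
    · rw [Finset.card_image_of_injective _ hinj, hreg, hcdeg]
  have hsurj : Function.Surjective f := by
    intro y
    refine closed_univ hconn (Set.range f) (f ⟨0, by omega⟩) ⟨_, rfl⟩ ?_ y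
    rintro u v ⟨i, rfl⟩ h
    rw [← mem_nb, ← himg] at h
    obtain ⟨j, -, rfl⟩ := Finset.mem_image.1 h
    exact ⟨j, rfl⟩
  refine ⟨n, hn, ⟨(RelIso.mk (Equiv.ofBijective f ⟨hinj, hsurj⟩) ?_ : cycleGraph n ≃g G).symm⟩⟩
  intro i j
  change G.Adj (f i) (f j) ↔ _
  constructor
  · intro h
    rw [← mem_nb, ← himg] at h
    obtain ⟨l, hl, he⟩ := Finset.mem_image.1 h
    rw [← hinj he]
    exact mem_nb.1 hl
  · exact hhom i j

def fourIso : cycleGraph 4 ≃g completeBipartiteGraph (Fin 2) (Fin 2) where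
  toFun := ![Sum.inl 0, Sum.inr 0, Sum.inl 1, Sum.inr 1]
  invFun := Sum.elim ![0, 2] ![1, 3]
  left_inv := by decide
  right_inv := by decide
  map_rel_iff' := by
    intro a b
    fin_cases a <;> fin_cases b <;> simp [cycleGraph_adj] <;> decide

theorem trichotomy {V : Type*} [Fintype V] (G : SimpleGraph V)
    (hconn : G.Connected) (hdeg : 1 ≤ G.maxDeg) :
    Nonempty (G ≃g completeBipartiteGraph (Fin G.maxDeg) (Fin G.maxDeg)) ∨
      Nonempty (G ≃g cycleGraph 6) ∨ Good G (2 * G.maxDeg - 1) := by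
  classical
  by_cases h1 : G.maxDeg = 1
  · left; rw [h1]; exact deg_one hconn h1
  by_cases hbad : ∃ x, ¬ Bad G G.maxDeg x
  · obtain ⟨x, hx⟩ := hbad
    right; right
    exact main_coloring hconn _ (by omega) (card_nb_le G) x hx
  push Not at hbad
  by_cases h2 : G.maxDeg = 2
  · obtain ⟨n, hn, ⟨e⟩⟩ := cyc_of_regular hconn (fun v => h2 ▸ (hbad v).1)
    rw [h2]
    rcases Nat.mod_two_eq_zero_or_one n with hp | hp
    · by_cases h4 : n = 4
      · subst h4
        left; exact ⟨e.trans fourIso⟩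
      by_cases h6 : n = 6
      · subst h6
        right; left; exact ⟨e⟩
      · right; right
        exact good_iso e (good_cyc_even (by omega) hp)
    · right; right
      exact good_iso e (good_cyc_odd hn hp)
  · left
    exact all_bad hconn _ (by omega) hbad

theorem maxDeg_six {V : Type*} [Fintype V] {G : SimpleGraph V} (e : G ≃g cycleGraph 6) :
    G.maxDeg = 2 := by
  classical
  have : Nonempty V := ⟨e.symm 0⟩
  obtain ⟨v, hv⟩ := exists_card_nb G
  rw [← hv]
  have : (nb G v).map e.toEquiv.toEmbedding = nb (cycleGraph 6) (e v) := by
    ext w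
    simp only [mem_nb, Finset.mem_map]
    constructor
    · rintro ⟨u, hu, rfl⟩
      exact e.map_adj_iff.2 hu
    · intro h
      refine ⟨e.symm w, ?_, by simp⟩
      rw [← e.map_adj_iff]; simpa using h
  rw [← Finset.card_map e.toEquiv.toEmbedding, this, nb_eq,
    SimpleGraph.card_neighborFinset_eq_degree, cycleGraph_degree_three_le]

end DCN

theorem statement_0 {V : Type*} [Fintype V] (G : SimpleGraph V)
    (hconn : G.Connected) (hdeg : 1 ≤ G.maxDeg) :
    G.distChromNum ≤ 2 * G.maxDeg ∧
      (G.distChromNum = 2 * G.maxDeg ↔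
        Nonempty (G ≃g completeBipartiteGraph (Fin G.maxDeg) (Fin G.maxDeg)) ∨
        Nonempty (G ≃g cycleGraph 6)) := by
  have hK : Nonempty (G ≃g completeBipartiteGraph (Fin G.maxDeg) (Fin G.maxDeg)) →
      G.distChromNum = 2 * G.maxDeg := by
    rintro ⟨e⟩
    have hg := DCN.good_iso e (DCN.good_bip _)
    exact le_antisymm (DCN.dist_le hg)
      (DCN.le_dist hg fun l hl => DCN.bip_lower (DCN.good_iso e.symm hl))
  have hC : Nonempty (G ≃g cycleGraph 6) → G.distChromNum = 2 * G.maxDeg := by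
    rintro ⟨e⟩
    rw [DCN.maxDeg_six e]
    have hg := DCN.good_iso e DCN.good_cyc_six
    exact le_antisymm (DCN.dist_le hg)
      (DCN.le_dist hg fun l hl => DCN.six_lower (DCN.good_iso e.symm hl))
  rcases DCN.trichotomy G hconn hdeg with h | h | h
  · exact ⟨(hK h).le, fun _ => Or.inl h, fun _ => hK h⟩
  · exact ⟨(hC h).le, fun _ => Or.inr h, fun _ => hC h⟩
  · have := DCN.dist_le h
    refine ⟨by omega, fun h => by omega, ?_⟩
    rintro (h | h)
    · exact hK h
    · exact hC h
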